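/- (1) If φ : C → D is a weak equivalence in Fun(BG, ∗Cat_ℂ), then the induced morphism φ⋊^alg G : C⋊^alg G → D⋊^alg G is a unitary equivalence. (2) If φ : C → D is a weak equivalence in Fun(BG, C*Cat), then the induced morphism φ⋊G : C⋊G → D⋊G is a unitary equivalence. -/

import Mathlib

noncomputable section

open scoped ENNReal

/-- A possibly non-unital ℂ-linear ∗-category. -/
structure StarCatNu : Type 1 where
  Obj : Type
  Hom : Obj → Obj → Type
  [homAddCommGroup : ∀ X Y, AddCommGroup (Hom X Y)]
  [homModule : ∀ X Y, Module ℂ (Hom X Y)]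
  comp : ∀ {X Y Z : Obj}, Hom Y Z → Hom X Y → Hom X Z
  star : ∀ {X Y : Obj}, Hom X Y → Hom Y X
  comp_assoc : ∀ {W X Y Z : Obj} (h : Hom Y Z) (g : Hom X Y) (f : Hom W X),
    comp (comp h g) f = comp h (comp g f)
  add_comp : ∀ {X Y Z : Obj} (g g' : Hom Y Z) (f : Hom X Y),
    comp (g + g') f = comp g f + comp g' f
  comp_add : ∀ {X Y Z : Obj} (g : Hom Y Z) (f f' : Hom X Y),
    comp g (f + f') = comp g f + comp g f'
  smul_comp : ∀ {X Y Z : Obj} (c : ℂ) (g : Hom Y Z) (f : Hom X Y),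
    comp (c • g) f = c • comp g f
  comp_smul : ∀ {X Y Z : Obj} (c : ℂ) (g : Hom Y Z) (f : Hom X Y),
    comp g (c • f) = c • comp g f
  star_star : ∀ {X Y : Obj} (f : Hom X Y), star (star f) = f
  star_comp : ∀ {X Y Z : Obj} (g : Hom Y Z) (f : Hom X Y),
    star (comp g f) = comp (star f) (star g)
  star_add : ∀ {X Y : Obj} (f f' : Hom X Y), star (f + f') = star f + star f'
  star_smul : ∀ {X Y : Obj} (c : ℂ) (f : Hom X Y),
    star (c • f) = (starRingEnd ℂ) c • star f

attribute [instance] StarCatNu.homAddCommGroup StarCatNu.homModule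

namespace StarCatNu

/-- Transport of morphisms along equalities of objects. -/
def castHom (C : StarCatNu) {X X' Y Y' : C.Obj} (hX : X = X') (hY : Y = Y')
    (f : C.Hom X Y) : C.Hom X' Y' := hX ▸ hY ▸ f

theorem comp_zero (C : StarCatNu) {X Y Z : C.Obj} (g : C.Hom Y Z) :
    C.comp g (0 : C.Hom X Y) = 0 :=
  (AddMonoidHom.mk' (fun f : C.Hom X Y => C.comp g f) (C.comp_add g)).map_zero

theorem zero_comp (C : StarCatNu) {X Y Z : C.Obj} (f : C.Hom X Y) :
    C.comp (0 : C.Hom Y Z) f = 0 :=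
  (AddMonoidHom.mk' (fun g : C.Hom Y Z => C.comp g f) (fun a b => C.add_comp a b f)).map_zero

theorem star_zero' (C : StarCatNu) {X Y : C.Obj} :
    C.star (0 : C.Hom X Y) = 0 :=
  (AddMonoidHom.mk' (fun f : C.Hom X Y => C.star f) C.star_add).map_zero

end StarCatNu

/-- A (not necessarily unit-preserving) functor between possibly non-unital ℂ-linear
∗-categories, compatible with the enrichment and the involutions. -/
structure StarFunctor (C D : StarCatNu) where
  obj : C.Obj → D.Obj
  map : ∀ {X Y : C.Obj}, C.Hom X Y → D.Hom (obj X) (obj Y)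
  map_add : ∀ (X Y : C.Obj) (f f' : C.Hom X Y), map (f + f') = map f + map f'
  map_smul : ∀ (X Y : C.Obj) (c : ℂ) (f : C.Hom X Y), map (c • f) = c • map f
  map_comp : ∀ (X Y Z : C.Obj) (g : C.Hom Y Z) (f : C.Hom X Y),
    map (C.comp g f) = D.comp (map g) (map f)
  map_star : ∀ (X Y : C.Obj) (f : C.Hom X Y), map (C.star f) = D.star (map f)

namespace StarFunctor

theorem map_zero {C D : StarCatNu} (F : StarFunctor C D) (X Y : C.Obj) :
    F.map (0 : C.Hom X Y) = 0 :=
  (AddMonoidHom.mk' (fun f : C.Hom X Y => F.map f) (F.map_add X Y)).map_zero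

/-- The identity functor. -/
def id (C : StarCatNu) : StarFunctor C C where
  obj X := X
  map f := f
  map_add _ _ _ _ := rfl
  map_smul _ _ _ _ := rfl
  map_comp _ _ _ _ _ := rfl
  map_star _ _ _ := rfl

/-- Composition of functors: first `F`, then `G`. -/
def comp {C D E : StarCatNu} (F : StarFunctor C D) (G : StarFunctor D E) :
    StarFunctor C E where
  obj X := G.obj (F.obj X)
  map f := G.map (F.map f)
  map_add X Y f f' := by
    show G.map (F.map (f + f')) = G.map (F.map f) + G.map (F.map f')
    rw [F.map_add, G.map_add]
  map_smul X Y c f := by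
    show G.map (F.map (c • f)) = c • G.map (F.map f)
    rw [F.map_smul, G.map_smul]
  map_comp X Y Z g f := by
    show G.map (F.map (C.comp g f)) = E.comp (G.map (F.map g)) (G.map (F.map f))
    rw [F.map_comp, G.map_comp]
  map_star X Y f := by
    show G.map (F.map (C.star f)) = E.star (G.map (F.map f))
    rw [F.map_star, G.map_star]

end StarFunctor

instance : CategoryTheory.Category StarCatNu where
  Hom := StarFunctor
  id := StarFunctor.id
  comp := StarFunctor.comp
  id_comp := by intros; rfl
  comp_id := by intros; rfl
  assoc := by intros; rfl
/-- A possibly non-unital ∗-algebra over ℂ regarded as a ℂ-linear ∗-category with a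
single object. -/
def StarCatNu.ofAlgebra (B : Type) [NonUnitalRing B] [Module ℂ B]
    [SMulCommClass ℂ B B] [IsScalarTower ℂ B B] [StarRing B] [StarModule ℂ B] :
    StarCatNu where
  Obj := PUnit
  Hom _ _ := B
  comp g f := g * f
  star b := Star.star b
  comp_assoc h g f := mul_assoc h g f
  add_comp g g' f := add_mul g g' f
  comp_add g f f' := mul_add g f f'
  smul_comp c g f := smul_mul_assoc c g f
  comp_smul c g f := mul_smul_comm c g f
  star_star f := InvolutiveStar.star_involutive f
  star_comp g f := StarMul.star_mul g f
  star_add f f' := StarAddMonoid.star_add f f'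
  star_smul c f := by
    show Star.star (c • f) = (starRingEnd ℂ) c • Star.star f
    rw [StarModule.star_smul, starRingEnd_apply]

/-- The maximal semi-norm of a morphism in a possibly non-unital ℂ-linear ∗-category:
the supremum of `‖ρ f‖` over all morphisms `ρ` into C*-algebras regarded as one-object
ℂ-linear ∗-categories. -/
noncomputable def StarCatNu.repNorm (C : StarCatNu) {X Y : C.Obj} (f : C.Hom X Y)
    (B : Type) [NonUnitalCStarAlgebra B] (ρ : StarFunctor C (StarCatNu.ofAlgebra B)) : ℝ≥0∞ :=
  (‖id (α := B) (ρ.map f)‖₊ : ℝ≥0∞)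

noncomputable def StarCatNu.maxNorm (C : StarCatNu) {X Y : C.Obj} (f : C.Hom X Y) : ℝ≥0∞ :=
  sSup { r : ℝ≥0∞ | ∃ (B : Type) (i : NonUnitalCStarAlgebra B)
    (ρ : StarFunctor C (StarCatNu.ofAlgebra B)), r = @StarCatNu.repNorm C X Y f B i ρ }

/-- A pre-C*-category: all morphisms have finite maximal semi-norm. -/
def IsPreCStar (C : StarCatNu) : Prop :=
  ∀ (X Y : C.Obj) (f : C.Hom X Y), C.maxNorm f < ⊤

/-- A C*-category: the maximal semi-norm is a finite norm and the morphism spaces are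
complete with respect to it (completeness is expressed via Cauchy sequences). -/
def IsCStar (C : StarCatNu) : Prop :=
  IsPreCStar C ∧
  (∀ (X Y : C.Obj) (f : C.Hom X Y), C.maxNorm f = 0 → f = 0) ∧
  (∀ (X Y : C.Obj) (u : ℕ → C.Hom X Y),
    (∀ ε : ℝ≥0∞, 0 < ε → ∃ N, ∀ m ≥ N, ∀ n ≥ N, C.maxNorm (u m - u n) < ε) →
    ∃ f : C.Hom X Y, ∀ ε : ℝ≥0∞, 0 < ε → ∃ N, ∀ n ≥ N, C.maxNorm (u n - f) < ε)

/-- `e` is an identity morphism at its object. -/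
def IsIdentityAt (C : StarCatNu) {X : C.Obj} (e : C.Hom X X) : Prop :=
  (∀ (Y : C.Obj) (f : C.Hom X Y), C.comp f e = f) ∧
  (∀ (Y : C.Obj) (g : C.Hom Y X), C.comp e g = g)

/-- A ℂ-linear ∗-category is unital if every object admits an identity morphism. -/
def StarCatNu.IsUnital (C : StarCatNu) : Prop :=
  ∀ X : C.Obj, ∃ e : C.Hom X X, IsIdentityAt C e

/-- A functor is unital if it sends identity morphisms to identity morphisms. -/
def StarFunctor.Unital {C D : StarCatNu} (F : StarFunctor C D) : Prop :=
  ∀ (X : C.Obj) (e : C.Hom X X), IsIdentityAt C e → IsIdentityAt D (F.map e)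

/-- A morphism `u` is unitary if `u* ∘ u` and `u ∘ u*` are identity morphisms. -/
def IsUnitary (D : StarCatNu) {A B : D.Obj} (u : D.Hom A B) : Prop :=
  IsIdentityAt D (D.comp (D.star u) u) ∧ IsIdentityAt D (D.comp u (D.star u))

/-- A unitary natural transformation between two functors. -/
structure UnitaryTrans {C D : StarCatNu} (F G : StarFunctor C D) where
  app : ∀ X : C.Obj, D.Hom (F.obj X) (G.obj X)
  natural : ∀ (X Y : C.Obj) (f : C.Hom X Y),
    D.comp (app Y) (F.map f) = D.comp (G.map f) (app X)
  unitary : ∀ X : C.Obj, IsUnitary D (app X)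

/-- A functor is a unitary equivalence if it is invertible up to unitary isomorphism. -/
def IsUnitaryEquiv {C D : StarCatNu} (F : StarFunctor C D) : Prop :=
  ∃ H : StarFunctor D C,
    Nonempty (UnitaryTrans (F.comp H) (StarFunctor.id C)) ∧
    Nonempty (UnitaryTrans (H.comp F) (StarFunctor.id D))

/-- A quotient morphism: bijective on objects and surjective on all morphism spaces. -/
def IsQuotientHom {C D : StarCatNu} (F : StarFunctor C D) : Prop :=
  Function.Bijective F.obj ∧
  ∀ (X Y : C.Obj), Function.Surjective (fun f : C.Hom X Y => F.map f)

/-- An exact sequence `0 → C → D → Q → 0`: `p` is a quotient morphism and `i` is the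
inclusion of its kernel. -/
structure IsExactSeq {C D Q : StarCatNu} (i : StarFunctor C D) (p : StarFunctor D Q) : Prop where
  i_obj_bij : Function.Bijective i.obj
  i_map_inj : ∀ (X Y : C.Obj), Function.Injective (fun f : C.Hom X Y => i.map f)
  p_quot : IsQuotientHom p
  exact : ∀ (X Y : C.Obj) (f : D.Hom (i.obj X) (i.obj Y)),
    p.map f = 0 ↔ ∃ g : C.Hom X Y, i.map g = f

/-- `ι : C → Cc` exhibits the C*-category `Cc` as the completion of the pre-C*-category `C`
with respect to the maximal semi-norm. -/
structure IsCompletion (C Cc : StarCatNu) (ι : StarFunctor C Cc) : Prop where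
  pre : IsPreCStar C
  cstar : IsCStar Cc
  obj_bij : Function.Bijective ι.obj
  isometric : ∀ (X Y : C.Obj) (f : C.Hom X Y), Cc.maxNorm (ι.map f) = C.maxNorm f
  dense : ∀ (X Y : C.Obj) (h : Cc.Hom (ι.obj X) (ι.obj Y)) (ε : ℝ≥0∞), 0 < ε →
    ∃ f : C.Hom X Y, Cc.maxNorm (h - ι.map f) < ε
/-- An action of a group `G` on a possibly non-unital ℂ-linear ∗-category `C` by
automorphisms (an object of `Fun(BG, ∗Cat^nu_ℂ)`). -/
structure GAction (G : Type) [Group G] (C : StarCatNu) where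
  actObj : G → C.Obj → C.Obj
  actMap : ∀ (g : G) {X Y : C.Obj}, C.Hom X Y → C.Hom (actObj g X) (actObj g Y)
  one_obj : ∀ X : C.Obj, actObj 1 X = X
  mul_obj : ∀ (g h : G) (X : C.Obj), actObj g (actObj h X) = actObj (g * h) X
  one_map : ∀ (X Y : C.Obj) (f : C.Hom X Y),
    C.castHom (one_obj X) (one_obj Y) (actMap 1 f) = f
  mul_map : ∀ (g h : G) (X Y : C.Obj) (f : C.Hom X Y),
    C.castHom (mul_obj g h X) (mul_obj g h Y) (actMap g (actMap h f)) = actMap (g * h) f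
  map_add : ∀ (g : G) (X Y : C.Obj) (f f' : C.Hom X Y),
    actMap g (f + f') = actMap g f + actMap g f'
  map_smul : ∀ (g : G) (X Y : C.Obj) (c : ℂ) (f : C.Hom X Y),
    actMap g (c • f) = c • actMap g f
  map_comp : ∀ (g : G) (X Y Z : C.Obj) (u : C.Hom Y Z) (f : C.Hom X Y),
    actMap g (C.comp u f) = C.comp (actMap g u) (actMap g f)
  map_star : ∀ (g : G) (X Y : C.Obj) (f : C.Hom X Y),
    actMap g (C.star f) = C.star (actMap g f)

namespace GAction

variable {G : Type} [Group G] {C : StarCatNu}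

/-- The automorphism of `C` given by the action of `g`. -/
def functor (α : GAction G C) (g : G) : StarFunctor C C where
  obj := α.actObj g
  map := α.actMap g
  map_add := α.map_add g
  map_smul := α.map_smul g
  map_comp := α.map_comp g
  map_star := α.map_star g

theorem inv_mul_obj (α : GAction G C) (g g' : G) (Z : C.Obj) :
    α.actObj g⁻¹ (α.actObj g'⁻¹ Z) = α.actObj (g' * g)⁻¹ Z := by
  rw [α.mul_obj, mul_inv_rev]

theorem cancel_obj (α : GAction G C) (g : G) (Y : C.Obj) :
    α.actObj g (α.actObj g⁻¹ Y) = Y := by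
  rw [α.mul_obj, mul_inv_cancel, α.one_obj]

theorem inv_inv_obj (α : GAction G C) (g : G) (X : C.Obj) :
    α.actObj g⁻¹⁻¹ X = α.actObj g X := by rw [inv_inv]

theorem one_inv_obj (α : GAction G C) (Y : C.Obj) :
    α.actObj (1 : G)⁻¹ Y = Y := by rw [inv_one, α.one_obj]

theorem lc_obj (α : GAction G C) (a b : G) (Y : C.Obj) :
    α.actObj a⁻¹ Y = α.actObj (b⁻¹ * a)⁻¹ (α.actObj b⁻¹ Y) := by
  rw [α.mul_obj]
  congr 1
  group

end GAction

/-- `CG` together with the data `obj`, `ins` is a realization of the algebraic crossed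
product `C ⋊^alg G`: its objects are those of `C`, its morphism spaces are the direct sums
`⊕_{g ∈ G} Hom_C(X, g⁻¹Y)` (the element of the `g`-th summand corresponding to `f` being
`ins g f`, i.e. `(f, g)`), with composition `(f', g') ∘ (f, g) = (g⁻¹f' ∘ f, g'g)` and
involution `(f, g)* = (g f*, g⁻¹)`. -/
structure IsCrossedProductAlg (G : Type) [Group G] (C : StarCatNu) (α : GAction G C)
    (CG : StarCatNu) where
  obj : C.Obj → CG.Obj
  obj_bij : Function.Bijective obj
  ins : ∀ (g : G) {X Y : C.Obj}, C.Hom X (α.actObj g⁻¹ Y) → CG.Hom (obj X) (obj Y)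
  ins_add : ∀ (g : G) (X Y : C.Obj) (f f' : C.Hom X (α.actObj g⁻¹ Y)),
    ins g (f + f') = ins g f + ins g f'
  ins_smul : ∀ (g : G) (X Y : C.Obj) (c : ℂ) (f : C.Hom X (α.actObj g⁻¹ Y)),
    ins g (c • f) = c • ins g f
  ins_comp : ∀ (g g' : G) (X Y Z : C.Obj)
    (f : C.Hom X (α.actObj g⁻¹ Y)) (f' : C.Hom Y (α.actObj g'⁻¹ Z)),
    CG.comp (ins g' f') (ins g f) =
      ins (g' * g) (C.castHom rfl (α.inv_mul_obj g g' Z)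
        (C.comp (α.actMap g⁻¹ f') f))
  ins_star : ∀ (g : G) (X Y : C.Obj) (f : C.Hom X (α.actObj g⁻¹ Y)),
    CG.star (ins g f) =
      ins g⁻¹ (C.castHom (α.cancel_obj g Y) (α.inv_inv_obj g X).symm
        (α.actMap g (C.star f)))
  span : ∀ (X Y : C.Obj) (u : CG.Hom (obj X) (obj Y)),
    ∃ (s : Finset G) (φ : ∀ g : G, C.Hom X (α.actObj g⁻¹ Y)),
      u = s.sum fun g => ins g (φ g)
  indep : ∀ (X Y : C.Obj) (s : Finset G) (φ : ∀ g : G, C.Hom X (α.actObj g⁻¹ Y)),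
    (s.sum fun g => ins g (φ g)) = 0 → ∀ g ∈ s, φ g = 0

/-- A (strictly) equivariant morphism between ℂ-linear ∗-categories with `G`-action,
i.e. a morphism in `Fun(BG, ∗Cat^nu_ℂ)`. -/
structure EquivariantMap {G : Type} [Group G] {C D : StarCatNu}
    (α : GAction G C) (β : GAction G D) (φ : StarFunctor C D) : Prop where
  obj_comm : ∀ (g : G) (X : C.Obj), φ.obj (α.actObj g X) = β.actObj g (φ.obj X)
  map_comm : ∀ (g : G) (X Y : C.Obj) (f : C.Hom X Y),
    D.castHom (obj_comm g X) (obj_comm g Y) (φ.map (α.actMap g f)) =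
      β.actMap g (φ.map f)

/-- The morphism `φ ⋊^alg G : C ⋊^alg G → D ⋊^alg G` induced by an equivariant morphism
`φ : C → D`: it acts like `φ` on objects and sends `(f, g)` to `(φ(f), g)`. -/
structure IsCrossedMap {G : Type} [Group G] {C D : StarCatNu}
    (α : GAction G C) (β : GAction G D) (φ : StarFunctor C D)
    (hφ : EquivariantMap α β φ) {CG DG : StarCatNu}
    (hC : IsCrossedProductAlg G C α CG) (hD : IsCrossedProductAlg G D β DG)
    (ψ : StarFunctor CG DG) : Prop where
  obj_eq : ∀ X : C.Obj, ψ.obj (hC.obj X) = hD.obj (φ.obj X)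
  map_eq : ∀ (g : G) (X Y : C.Obj) (f : C.Hom X (α.actObj g⁻¹ Y)),
    DG.castHom (obj_eq X) (obj_eq Y) (ψ.map (hC.ins g f)) =
      hD.ins g (D.castHom rfl (hφ.obj_comm g⁻¹ Y) (φ.map f))

/-- The morphism `φ ⋊ G : C ⋊ G → D ⋊ G` of completed crossed products induced by an
equivariant morphism `φ : C → D` of C*-categories with `G`-action. -/
structure IsCrossedMapC {G : Type} [Group G] {C D : StarCatNu}
    (α : GAction G C) (β : GAction G D) (φ : StarFunctor C D)
    (hφ : EquivariantMap α β φ) {CG DG CGc DGc : StarCatNu}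
    (hC : IsCrossedProductAlg G C α CG) (hD : IsCrossedProductAlg G D β DG)
    (κC : StarFunctor CG CGc) (κD : StarFunctor DG DGc)
    (ψ : StarFunctor CGc DGc) : Prop where
  obj_eq : ∀ X : C.Obj, ψ.obj (κC.obj (hC.obj X)) = κD.obj (hD.obj (φ.obj X))
  map_eq : ∀ (g : G) (X Y : C.Obj) (f : C.Hom X (α.actObj g⁻¹ Y)),
    DGc.castHom (obj_eq X) (obj_eq Y) (ψ.map (κC.map (hC.ins g f))) =
      κD.map (hD.ins g (D.castHom rfl (hφ.obj_comm g⁻¹ Y) (φ.map f)))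

section Helpers

/-! ### Casts -/

theorem StarCatNu.castHom_heq (C : StarCatNu) {X X' Y Y' : C.Obj} (hX : X = X') (hY : Y = Y')
    (f : C.Hom X Y) : HEq (C.castHom hX hY f) f := by
  subst hX; subst hY; rfl

theorem StarCatNu.castHom_bij (C : StarCatNu) {X X' Y Y' : C.Obj} (hX : X = X') (hY : Y = Y') :
    Function.Bijective (C.castHom hX hY) := by
  subst hX; subst hY; exact Function.bijective_id

theorem StarCatNu.castHom_add (C : StarCatNu) {X X' Y Y' : C.Obj} (hX : X = X') (hY : Y = Y')
    (f g : C.Hom X Y) : C.castHom hX hY (f + g) = C.castHom hX hY f + C.castHom hX hY g := by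
  subst hX; subst hY; rfl

theorem StarCatNu.castHom_sub (C : StarCatNu) {X X' Y Y' : C.Obj} (hX : X = X') (hY : Y = Y')
    (f g : C.Hom X Y) : C.castHom hX hY (f - g) = C.castHom hX hY f - C.castHom hX hY g := by
  subst hX; subst hY; rfl

theorem StarCatNu.castHom_zero (C : StarCatNu) {X X' Y Y' : C.Obj} (hX : X = X') (hY : Y = Y') :
    C.castHom hX hY (0 : C.Hom X Y) = 0 := by
  subst hX; subst hY; rfl

theorem StarCatNu.castHom_smul (C : StarCatNu) {X X' Y Y' : C.Obj} (hX : X = X') (hY : Y = Y')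
    (c : ℂ) (f : C.Hom X Y) : C.castHom hX hY (c • f) = c • C.castHom hX hY f := by
  subst hX; subst hY; rfl

theorem StarCatNu.castHom_maxNorm (C : StarCatNu) {X X' Y Y' : C.Obj} (hX : X = X') (hY : Y = Y')
    (f : C.Hom X Y) : C.maxNorm (C.castHom hX hY f) = C.maxNorm f := by
  subst hX; subst hY; rfl

theorem StarCatNu.castHom_unitary (C : StarCatNu) {X X' Y Y' : C.Obj} (hX : X = X') (hY : Y = Y')
    (f : C.Hom X Y) (hf : IsUnitary C f) : IsUnitary C (C.castHom hX hY f) := by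
  subst hX; subst hY; exact hf

theorem StarCatNu.comp_heq (C : StarCatNu) {X X' Y Y' Z Z' : C.Obj} (hX : X = X') (hY : Y = Y')
    (hZ : Z = Z') {g : C.Hom Y Z} {g' : C.Hom Y' Z'} {f : C.Hom X Y} {f' : C.Hom X' Y'}
    (hg : HEq g g') (hf : HEq f f') : HEq (C.comp g f) (C.comp g' f') := by
  subst hX; subst hY; subst hZ; cases hg; cases hf; rfl

theorem StarCatNu.star_heq (C : StarCatNu) {X X' Y Y' : C.Obj} (hX : X = X') (hY : Y = Y')
    {f : C.Hom X Y} {f' : C.Hom X' Y'} (hf : HEq f f') : HEq (C.star f) (C.star f') := by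
  subst hX; subst hY; cases hf; rfl

theorem StarFunctor.map_heq {C D : StarCatNu} (F : StarFunctor C D) {X X' Y Y' : C.Obj}
    (hX : X = X') (hY : Y = Y')
    {f : C.Hom X Y} {f' : C.Hom X' Y'} (hf : HEq f f') : HEq (F.map f) (F.map f') := by
  subst hX; subst hY; cases hf; rfl

theorem GAction.map_heq {G : Type} [Group G] {C : StarCatNu} (α : GAction G C) {g g' : G}
    (hg : g = g') {X X' Y Y' : C.Obj} (hX : X = X') (hY : Y = Y')
    {f : C.Hom X Y} {f' : C.Hom X' Y'} (hf : HEq f f') :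
    HEq (α.actMap g f) (α.actMap g' f') := by
  subst hg; subst hX; subst hY; cases hf; rfl

theorem GAction.one_heq {G : Type} [Group G] {C : StarCatNu} (α : GAction G C) {g : G}
    (hg : g = 1) {X Y : C.Obj} (f : C.Hom X Y) : HEq (α.actMap g f) f := by
  subst hg
  exact (C.castHom_heq _ _ _).symm.trans (heq_of_eq (α.one_map X Y f))

theorem IsCrossedProductAlg.ins_heq {G : Type} [Group G] {C : StarCatNu} {α : GAction G C}
    {CG : StarCatNu} (hC : IsCrossedProductAlg G C α CG) {g g' : G} (hg : g = g') {X Y : C.Obj}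
    {f : C.Hom X (α.actObj g⁻¹ Y)} {f' : C.Hom X (α.actObj g'⁻¹ Y)} (hf : HEq f f') :
    hC.ins g f = hC.ins g' f' := by
  subst hg; cases hf; rfl

theorem StarFunctor.map_neg {C D : StarCatNu} (F : StarFunctor C D) {X Y : C.Obj}
    (f : C.Hom X Y) : F.map (-f) = -F.map f :=
  (AddMonoidHom.mk' (fun f : C.Hom X Y => F.map f) (F.map_add X Y)).map_neg f

theorem StarFunctor.map_sub {C D : StarCatNu} (F : StarFunctor C D) {X Y : C.Obj}
    (f g : C.Hom X Y) : F.map (f - g) = F.map f - F.map g :=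
  (AddMonoidHom.mk' (fun f : C.Hom X Y => F.map f) (F.map_add X Y)).map_sub f g

theorem StarCatNu.comp_sub (C : StarCatNu) {X Y Z : C.Obj} (g : C.Hom Y Z) (f f' : C.Hom X Y) :
    C.comp g (f - f') = C.comp g f - C.comp g f' :=
  (AddMonoidHom.mk' (fun f : C.Hom X Y => C.comp g f) (C.comp_add g)).map_sub f f'

theorem StarCatNu.sub_comp (C : StarCatNu) {X Y Z : C.Obj} (g g' : C.Hom Y Z) (f : C.Hom X Y) :
    C.comp (g - g') f = C.comp g f - C.comp g' f :=
  (AddMonoidHom.mk' (fun g : C.Hom Y Z => C.comp g f) (fun a b => C.add_comp a b f)).map_sub g g'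

/-! ### Identities and unitaries -/

theorem IsIdentityAt.eq {C : StarCatNu} {X : C.Obj} {e e' : C.Hom X X} (h : IsIdentityAt C e)
    (h' : IsIdentityAt C e') : e = e' := by
  rw [← h.1 _ e', h'.2]

theorem IsIdentityAt.star_eq {C : StarCatNu} {X : C.Obj} {e : C.Hom X X}
    (h : IsIdentityAt C e) : C.star e = e := by
  have h1 : C.comp e (C.star e) = C.star e := h.2 _ _
  have h2 := congrArg C.star h1
  rw [C.star_comp, C.star_star, h1] at h2
  exact h2

theorem IsIdentityAt.isUnitary {C : StarCatNu} {X : C.Obj} {e : C.Hom X X}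
    (h : IsIdentityAt C e) : IsUnitary C e := by
  have : C.comp e e = e := h.1 _ _
  constructor <;> rw [h.star_eq, this] <;> exact h

theorem IsUnitary.star {C : StarCatNu} {X Y : C.Obj} {u : C.Hom X Y} (h : IsUnitary C u) :
    IsUnitary C (C.star u) := by
  refine ⟨?_, ?_⟩ <;> rw [C.star_star]
  exacts [h.2, h.1]

theorem StarFunctor.Unital.unitary {C D : StarCatNu} {F : StarFunctor C D} (hF : F.Unital)
    {X Y : C.Obj} {u : C.Hom X Y} (h : IsUnitary C u) : IsUnitary D (F.map u) := by
  refine ⟨?_, ?_⟩ <;> rw [← F.map_star, ← F.map_comp]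
  exacts [hF _ _ h.1, hF _ _ h.2]

namespace IsUnitary
variable {C : StarCatNu} {X Y : C.Obj} {u : C.Hom X Y} {Z : C.Obj}
theorem c1 (h : IsUnitary C u) (f : C.Hom Z X) : C.comp (C.star u) (C.comp u f) = f := by
  rw [← C.comp_assoc, h.1.2]
theorem c2 (h : IsUnitary C u) (f : C.Hom Z Y) : C.comp u (C.comp (C.star u) f) = f := by
  rw [← C.comp_assoc, h.2.2]
theorem c3 (h : IsUnitary C u) (f : C.Hom X Z) : C.comp (C.comp f (C.star u)) u = f := by
  rw [C.comp_assoc, h.1.1]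
theorem c4 (h : IsUnitary C u) (f : C.Hom Y Z) : C.comp (C.comp f u) (C.star u) = f := by
  rw [C.comp_assoc, h.2.1]
end IsUnitary

/-! ### Fully faithful and unitarily essentially surjective -/

def StarFunctor.FF {C D : StarCatNu} (F : StarFunctor C D) : Prop :=
  ∀ X Y : C.Obj, Function.Bijective (fun f : C.Hom X Y => F.map f)

def StarFunctor.ES {C D : StarCatNu} (F : StarFunctor C D) : Prop :=
  ∀ Y : D.Obj, ∃ (X : C.Obj) (u : D.Hom (F.obj X) Y), IsUnitary D u

theorem StarFunctor.FF.identity {C D : StarCatNu} {F : StarFunctor C D} (hF : F.FF) {X : C.Obj}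
    {e : C.Hom X X} (he : IsIdentityAt D (F.map e)) : IsIdentityAt C e := by
  constructor
  · intro Y f
    apply (hF _ _).1
    show F.map _ = F.map _
    rw [F.map_comp, he.1]
  · intro Y f
    apply (hF _ _).1
    show F.map _ = F.map _
    rw [F.map_comp, he.2]

theorem StarFunctor.FF.unitary {C D : StarCatNu} {F : StarFunctor C D} (hF : F.FF) {X Y : C.Obj}
    {u : C.Hom X Y} (h : IsUnitary D (F.map u)) : IsUnitary C u := by
  refine ⟨hF.identity ?_, hF.identity ?_⟩ <;> rw [F.map_comp, F.map_star]
  exacts [h.1, h.2]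

theorem IsUnitaryEquiv.data {C D : StarCatNu} {F : StarFunctor C D} (h : IsUnitaryEquiv F) :
    ∃ (H : StarFunctor D C) (v : ∀ X : C.Obj, C.Hom (H.obj (F.obj X)) X)
      (w : ∀ Y : D.Obj, D.Hom (F.obj (H.obj Y)) Y),
      (∀ (X Y : C.Obj) (f : C.Hom X Y), C.comp (v Y) (H.map (F.map f)) = C.comp f (v X)) ∧
      (∀ X, IsUnitary C (v X)) ∧
      (∀ (X Y : D.Obj) (f : D.Hom X Y), D.comp (w Y) (F.map (H.map f)) = D.comp f (w X)) ∧
      (∀ Y, IsUnitary D (w Y)) := by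
  obtain ⟨H, ⟨v⟩, ⟨w⟩⟩ := h
  exact ⟨H, v.app, w.app, v.natural, v.unitary, w.natural, w.unitary⟩

theorem IsUnitaryEquiv.ofData {C D : StarCatNu} {F : StarFunctor C D}
    (H : StarFunctor D C) (v : ∀ X : C.Obj, C.Hom (H.obj (F.obj X)) X)
      (w : ∀ Y : D.Obj, D.Hom (F.obj (H.obj Y)) Y)
      (hv : ∀ (X Y : C.Obj) (f : C.Hom X Y), C.comp (v Y) (H.map (F.map f)) = C.comp f (v X))
      (hvu : ∀ X, IsUnitary C (v X))
      (hw : ∀ (X Y : D.Obj) (f : D.Hom X Y), D.comp (w Y) (F.map (H.map f)) = D.comp f (w X))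
      (hwu : ∀ Y, IsUnitary D (w Y)) : IsUnitaryEquiv F :=
  ⟨H, ⟨⟨v, hv, hvu⟩⟩, ⟨⟨w, hw, hwu⟩⟩⟩

theorem isUnitaryEquiv_of_ff_es {C D : StarCatNu} {F : StarFunctor C D} (hF : F.FF) (hE : F.ES) :
    IsUnitaryEquiv F := by
  choose o u hu using hE
  have hs : ∀ X Y : C.Obj, ∃ inv : D.Hom (F.obj X) (F.obj Y) → C.Hom X Y,
      ∀ d, F.map (inv d) = d := fun X Y => (hF X Y).2.hasRightInverse
  choose inv hinv using hs
  have inj : ∀ {X Y : C.Obj} {f f' : C.Hom X Y}, F.map f = F.map f' → f = f' :=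
    fun {X Y f f'} h => (hF X Y).1 h
  let H : StarFunctor D C :=
    { obj := o
      map := fun {A B} f => inv _ _ (D.comp (D.star (u B)) (D.comp f (u A)))
      map_add := by
        intro A B f f'; apply inj
        rw [F.map_add]; simp only [hinv, D.add_comp, D.comp_add]
      map_smul := by
        intro A B c f; apply inj
        rw [F.map_smul]; simp only [hinv, D.smul_comp, D.comp_smul]
      map_comp := by
        intro A B E g f; apply inj
        rw [F.map_comp]; simp only [hinv, D.comp_assoc, (hu _).c2]
      map_star := by
        intro A B f; apply inj
        rw [F.map_star]; simp only [hinv, D.star_comp, D.star_star, D.comp_assoc] }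
  have hH : ∀ {A B : D.Obj} (f : D.Hom A B),
      F.map (H.map f) = D.comp (D.star (u B)) (D.comp f (u A)) := fun f => hinv _ _ _
  refine IsUnitaryEquiv.ofData H (fun X => inv (o (F.obj X)) X (u (F.obj X))) u ?_ ?_ ?_ hu
  · intro X Y f
    apply inj
    refine (F.map_comp _ _ _ _ _).trans ?_
    rw [F.map_comp, hH]
    refine (congrArg (fun z => D.comp z _) (hinv _ _ _)).trans ?_
    rw [hinv]
    exact (hu _).c2 _
  · intro X
    apply hF.unitary
    have := hinv _ _ (u (F.obj X))
    exact this.symm ▸ hu (F.obj X)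
  · intro X Y f
    rw [hH]
    exact (hu _).c2 _

theorem nat_faithful {C : StarCatNu} {A X : C.Obj} {v : C.Hom A X} (hv : IsUnitary C v)
    {Y : C.Obj} {f f' : C.Hom X Y} (h3 : C.comp f v = C.comp f' v) : f = f' := by
  rw [← hv.c4 f, h3, hv.c4]

theorem IsUnitaryEquiv.es {C D : StarCatNu} {F : StarFunctor C D} (h : IsUnitaryEquiv F) :
    F.ES := by
  obtain ⟨H, v, w, hv, hvu, hw, hwu⟩ := h.data
  exact fun Y => ⟨H.obj Y, w Y, hwu Y⟩

theorem IsUnitaryEquiv.ff {C D : StarCatNu} {F : StarFunctor C D} (h : IsUnitaryEquiv F) :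
    F.FF := by
  obtain ⟨H, v, w, hv, hvu, hw, hwu⟩ := h.data
  intro X Y
  constructor
  · intro f f' hf
    have hf : F.map f = F.map f' := hf
    apply nat_faithful (hvu X)
    rw [← hv, ← hv, hf]
  · intro d
    refine ⟨C.comp (v Y) (C.comp (H.map d) (C.star (v X))), ?_⟩
    apply nat_faithful (hwu _)
    show D.comp (F.map (C.comp (v Y) (C.comp (H.map d) (C.star (v X))))) _ = _
    rw [← hw, ← hw]
    congr 2
    have h2 := hv X Y (C.comp (v Y) (C.comp (H.map d) (C.star (v X))))
    rw [C.comp_assoc, (hvu X).c3] at h2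
    exact ((hvu Y).c1 _).symm.trans
      ((congrArg (C.comp (C.star (v Y))) h2).trans ((hvu Y).c1 _))

theorem StarFunctor.FF.unital {C D : StarCatNu} {F : StarFunctor C D} (hF : F.FF)
    (hS : Function.Surjective F.obj) : F.Unital := by
  intro X e he
  constructor
  · intro Y f
    obtain ⟨Y, rfl⟩ := hS Y
    obtain ⟨f, rfl⟩ := (hF _ _).2 f
    show D.comp (F.map f) (F.map e) = F.map f
    rw [← F.map_comp, he.1]
  · intro Y f
    obtain ⟨Y, rfl⟩ := hS Y
    obtain ⟨f, rfl⟩ := (hF _ _).2 f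
    show D.comp (F.map e) (F.map f) = F.map f
    rw [← F.map_comp, he.2]

theorem isUnitaryEquiv_of_ff_surj {C D : StarCatNu} {F : StarFunctor C D} (hC : C.IsUnital)
    (hF : F.FF) (hS : Function.Surjective F.obj) : IsUnitaryEquiv F := by
  refine isUnitaryEquiv_of_ff_es hF fun Y => ?_
  obtain ⟨X, rfl⟩ := hS Y
  obtain ⟨e, he⟩ := hC X
  exact ⟨X, F.map e, (hF.unital hS).unitary he.isUnitary⟩

theorem es_of_square {A B A' B' : StarCatNu} {F : StarFunctor A B} (hF : F.ES)
    {P : StarFunctor A A'} {Q : StarFunctor B B'} (hQ : Q.Unital)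
    (hQs : Function.Surjective Q.obj)
    {ψ : StarFunctor A' B'} (ho : ∀ X, ψ.obj (P.obj X) = Q.obj (F.obj X)) : ψ.ES := by
  intro Y
  obtain ⟨Y, rfl⟩ := hQs Y
  obtain ⟨X, u, hu⟩ := hF Y
  exact ⟨P.obj X, B'.castHom (ho X).symm rfl (Q.map u), B'.castHom_unitary _ _ _ (hQ.unitary hu)⟩

theorem square_alg {A B A' B' : StarCatNu} {F : StarFunctor A B} (hF : IsUnitaryEquiv F)
    {P : StarFunctor A A'} {Q : StarFunctor B B'} (hP : P.FF) (hPs : Function.Surjective P.obj)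
    (hQ : Q.FF) (hQs : Function.Surjective Q.obj)
    {ψ : StarFunctor A' B'} (ho : ∀ X, ψ.obj (P.obj X) = Q.obj (F.obj X))
    (hm : ∀ (X Y : A.Obj) (f : A.Hom X Y),
      B'.castHom (ho X) (ho Y) (ψ.map (P.map f)) = Q.map (F.map f)) : IsUnitaryEquiv ψ := by
  refine isUnitaryEquiv_of_ff_es ?_ (es_of_square hF.es (hQ.unital hQs) hQs ho)
  intro X Y
  obtain ⟨X, rfl⟩ := hPs X
  obtain ⟨Y, rfl⟩ := hPs Y
  have h1 : Function.Bijective (fun f : A.Hom X Y => Q.map (F.map f)) :=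
    (hQ _ _).comp (hF.ff X Y)
  have h2 : (fun f : A.Hom X Y => Q.map (F.map f)) =
      B'.castHom (ho X) (ho Y) ∘ ((fun f => ψ.map f) ∘ (fun f => P.map f)) := by
    funext f; exact (hm X Y f).symm
  rw [h2] at h1
  have h3 := (Function.Bijective.of_comp_iff' (B'.castHom_bij (ho X) (ho Y)) _).1 h1
  exact (Function.Bijective.of_comp_iff _ (hP X Y)).1 h3

/-! ### The maximal norm -/

theorem StarCatNu.repNorm_le (C : StarCatNu) {X Y : C.Obj} (f : C.Hom X Y) (B : Type)
    [i : NonUnitalCStarAlgebra B] (ρ : StarFunctor C (StarCatNu.ofAlgebra B)) :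
    C.repNorm f B ρ ≤ C.maxNorm f :=
  le_sSup ⟨B, i, ρ, rfl⟩

theorem StarCatNu.maxNorm_le (C : StarCatNu) {X Y : C.Obj} (f : C.Hom X Y) (r : ℝ≥0∞)
    (h : ∀ (B : Type) [NonUnitalCStarAlgebra B] (ρ : StarFunctor C (StarCatNu.ofAlgebra B)),
      C.repNorm f B ρ ≤ r) : C.maxNorm f ≤ r := by
  apply sSup_le
  rintro _ ⟨B, i, ρ, rfl⟩
  exact h B ρ

theorem StarCatNu.repNorm_add (C : StarCatNu) {X Y : C.Obj} (f g : C.Hom X Y) (B : Type)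
    [NonUnitalCStarAlgebra B] (ρ : StarFunctor C (StarCatNu.ofAlgebra B)) :
    C.repNorm (f + g) B ρ ≤ C.repNorm f B ρ + C.repNorm g B ρ := by
  unfold StarCatNu.repNorm
  rw [ρ.map_add]
  exact_mod_cast nnnorm_add_le (id (α := B) (ρ.map f)) (id (α := B) (ρ.map g))

theorem StarCatNu.repNorm_neg (C : StarCatNu) {X Y : C.Obj} (f : C.Hom X Y) (B : Type)
    [NonUnitalCStarAlgebra B] (ρ : StarFunctor C (StarCatNu.ofAlgebra B)) :
    C.repNorm (-f) B ρ = C.repNorm f B ρ := by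
  unfold StarCatNu.repNorm
  rw [ρ.map_neg]
  exact_mod_cast nnnorm_neg (id (α := B) (ρ.map f))

theorem StarCatNu.repNorm_comp (C : StarCatNu) {X Y Z : C.Obj} (g : C.Hom Y Z) (f : C.Hom X Y)
    (B : Type) [NonUnitalCStarAlgebra B] (ρ : StarFunctor C (StarCatNu.ofAlgebra B)) :
    C.repNorm (C.comp g f) B ρ ≤ C.repNorm g B ρ * C.repNorm f B ρ := by
  unfold StarCatNu.repNorm
  rw [ρ.map_comp]
  exact_mod_cast nnnorm_mul_le (id (α := B) (ρ.map g)) (id (α := B) (ρ.map f))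

theorem norm_le_one_of_pi {B : Type} [NonUnitalCStarAlgebra B] (a : B)
    (h : a * (Star.star a * a) = a) : ‖a‖ ≤ 1 := by
  have h1 : (Star.star a * a) * (Star.star a * a) = Star.star a * a := by
    rw [mul_assoc, h]
  have h2 : ‖Star.star a * a‖ = ‖a‖ * ‖a‖ := CStarRing.norm_star_mul_self
  have h3 : ‖Star.star a * a‖ * ‖Star.star a * a‖ = ‖Star.star a * a‖ := by
    have := CStarRing.norm_star_mul_self (x := Star.star a * a)
    rw [star_mul, star_star, h1] at this
    exact this.symm
  rw [h2] at h3
  by_contra hc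
  push Not at hc
  have h4 : 1 < ‖a‖ * ‖a‖ := by nlinarith
  nlinarith

theorem StarCatNu.repNorm_pi (C : StarCatNu) {X Y : C.Obj} (f : C.Hom X Y)
    (h : C.comp f (C.comp (C.star f) f) = f) (B : Type)
    [NonUnitalCStarAlgebra B] (ρ : StarFunctor C (StarCatNu.ofAlgebra B)) :
    C.repNorm f B ρ ≤ 1 := by
  have h1 := congrArg (fun z => ρ.map z) h
  simp only [ρ.map_comp, ρ.map_star] at h1
  unfold StarCatNu.repNorm
  have := norm_le_one_of_pi (id (α := B) (ρ.map f)) h1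
  exact_mod_cast this

theorem IsUnitary.repNorm {C : StarCatNu} {X Y : C.Obj} {f : C.Hom X Y}
    (h : IsUnitary C f) (B : Type)
    [NonUnitalCStarAlgebra B] (ρ : StarFunctor C (StarCatNu.ofAlgebra B)) :
    C.repNorm f B ρ ≤ 1 :=
  C.repNorm_pi f (h.1.1 _ _) B ρ

theorem StarCatNu.maxNorm_add (C : StarCatNu) {X Y : C.Obj} (f g : C.Hom X Y) :
    C.maxNorm (f + g) ≤ C.maxNorm f + C.maxNorm g :=
  C.maxNorm_le _ _ fun B _ ρ => (C.repNorm_add f g B ρ).trans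
    (add_le_add (C.repNorm_le f B ρ) (C.repNorm_le g B ρ))

theorem StarCatNu.maxNorm_neg (C : StarCatNu) {X Y : C.Obj} (f : C.Hom X Y) :
    C.maxNorm (-f) = C.maxNorm f := by
  have : ∀ f : C.Hom X Y, C.maxNorm (-f) ≤ C.maxNorm f := fun f =>
    C.maxNorm_le _ _ fun B _ ρ => (C.repNorm_neg f B ρ).le.trans (C.repNorm_le f B ρ)
  apply le_antisymm (this f)
  simpa using this (-f)

theorem StarCatNu.maxNorm_comp (C : StarCatNu) {X Y Z : C.Obj} (g : C.Hom Y Z) (f : C.Hom X Y) :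
    C.maxNorm (C.comp g f) ≤ C.maxNorm g * C.maxNorm f :=
  C.maxNorm_le _ _ fun B _ ρ => (C.repNorm_comp g f B ρ).trans
    (mul_le_mul' (C.repNorm_le g B ρ) (C.repNorm_le f B ρ))

theorem StarCatNu.maxNorm_sub_comm (C : StarCatNu) {X Y : C.Obj} (f g : C.Hom X Y) :
    C.maxNorm (f - g) = C.maxNorm (g - f) := by
  rw [← C.maxNorm_neg, neg_sub]

theorem StarCatNu.maxNorm_tri (C : StarCatNu) {X Y : C.Obj} (f g h : C.Hom X Y) :
    C.maxNorm (f - h) ≤ C.maxNorm (f - g) + C.maxNorm (g - h) := by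
  have := C.maxNorm_add (f - g) (g - h)
  rwa [sub_add_sub_cancel] at this

theorem StarFunctor.maxNorm_map_le {C D : StarCatNu} (F : StarFunctor C D) {X Y : C.Obj}
    (f : C.Hom X Y) : D.maxNorm (F.map f) ≤ C.maxNorm f :=
  D.maxNorm_le _ _ fun B _ ρ => C.repNorm_le f B (F.comp ρ)

theorem IsUnitaryEquiv.maxNorm {C D : StarCatNu} {F : StarFunctor C D} (hF : IsUnitaryEquiv F)
    {X Y : C.Obj} (f : C.Hom X Y) : D.maxNorm (F.map f) = C.maxNorm f := by
  apply le_antisymm (F.maxNorm_map_le f)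
  obtain ⟨H, v, w, hv, hvu, hw, hwu⟩ := hF.data
  refine C.maxNorm_le _ _ fun B _ ρ => ?_
  have h2 : f = C.comp (C.comp (v Y) (H.map (F.map f))) (C.star (v X)) := by
    rw [hv, (hvu X).c4]
  calc C.repNorm f B ρ
      = C.repNorm (C.comp (C.comp (v Y) (H.map (F.map f))) (C.star (v X))) B ρ :=
        congrArg (fun z => C.repNorm z B ρ) h2
    _ ≤ C.repNorm (C.comp (v Y) (H.map (F.map f))) B ρ * C.repNorm (C.star (v X)) B ρ :=
        C.repNorm_comp _ _ B ρ
    _ ≤ (C.repNorm (v Y) B ρ * C.repNorm (H.map (F.map f)) B ρ) *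
          C.repNorm (C.star (v X)) B ρ := by gcongr; exact C.repNorm_comp _ _ B ρ
    _ ≤ (1 * C.repNorm (H.map (F.map f)) B ρ) * 1 := by
        gcongr
        · exact (hvu Y).repNorm B ρ
        · exact (hvu X).star.repNorm B ρ
    _ = D.repNorm (F.map f) B (H.comp ρ) := by rw [one_mul, mul_one]; rfl
    _ ≤ _ := D.repNorm_le _ B _

theorem ennreal_eq_zero_of_lt {a : ℝ≥0∞} (h : ∀ ε, 0 < ε → a < ε) : a = 0 := by
  by_contra hc
  exact lt_irrefl _ (h a (pos_iff_ne_zero.2 hc))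

theorem IsCStar.eq_of_lt {C : StarCatNu} (hC : IsCStar C) {X Y : C.Obj} {f g : C.Hom X Y}
    (h : ∀ ε, 0 < ε → C.maxNorm (f - g) < ε) : f = g :=
  sub_eq_zero.1 (hC.2.1 _ _ _ (ennreal_eq_zero_of_lt h))

theorem IsCompletion.unital {C Cc : StarCatNu} {κ : StarFunctor C Cc} (h : IsCompletion C Cc κ) :
    κ.Unital := by
  intro X e he
  have hn : Cc.maxNorm (κ.map e) ≤ 1 := by
    rw [h.isometric]
    exact C.maxNorm_le _ _ fun B _ ρ => he.isUnitary.repNorm B ρ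
  constructor
  · intro Y f
    obtain ⟨Y, rfl⟩ := h.obj_bij.2 Y
    apply h.cstar.eq_of_lt
    intro ε hε
    obtain ⟨f', hf'⟩ := h.dense _ _ f (ε / 2) (ENNReal.half_pos hε.ne')
    have h1 : Cc.comp (κ.map f') (κ.map e) = κ.map f' := by rw [← κ.map_comp, he.1]
    calc Cc.maxNorm (Cc.comp f (κ.map e) - f)
        ≤ Cc.maxNorm (Cc.comp f (κ.map e) - κ.map f') + Cc.maxNorm (κ.map f' - f) :=
          Cc.maxNorm_tri _ _ _
      _ = Cc.maxNorm (Cc.comp (f - κ.map f') (κ.map e)) + Cc.maxNorm (f - κ.map f') := by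
          rw [Cc.sub_comp, h1, Cc.maxNorm_sub_comm (κ.map f')]
      _ ≤ Cc.maxNorm (f - κ.map f') * 1 + Cc.maxNorm (f - κ.map f') := by
          gcongr
          exact (Cc.maxNorm_comp _ _).trans (by gcongr)
      _ < ε / 2 + ε / 2 := by rw [mul_one]; exact ENNReal.add_lt_add hf' hf'
      _ = ε := ENNReal.add_halves ε
  · intro Y f
    obtain ⟨Y, rfl⟩ := h.obj_bij.2 Y
    apply h.cstar.eq_of_lt
    intro ε hε
    obtain ⟨f', hf'⟩ := h.dense _ _ f (ε / 2) (ENNReal.half_pos hε.ne')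
    have h1 : Cc.comp (κ.map e) (κ.map f') = κ.map f' := by rw [← κ.map_comp, he.2]
    calc Cc.maxNorm (Cc.comp (κ.map e) f - f)
        ≤ Cc.maxNorm (Cc.comp (κ.map e) f - κ.map f') + Cc.maxNorm (κ.map f' - f) :=
          Cc.maxNorm_tri _ _ _
      _ = Cc.maxNorm (Cc.comp (κ.map e) (f - κ.map f')) + Cc.maxNorm (f - κ.map f') := by
          rw [Cc.comp_sub, h1, Cc.maxNorm_sub_comm (κ.map f')]
      _ ≤ 1 * Cc.maxNorm (f - κ.map f') + Cc.maxNorm (f - κ.map f') := by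
          gcongr
          exact (Cc.maxNorm_comp _ _).trans (by gcongr)
      _ < ε / 2 + ε / 2 := by rw [one_mul]; exact ENNReal.add_lt_add hf' hf'
      _ = ε := ENNReal.add_halves ε

theorem IsCompletion.precomp {A C Cc : StarCatNu} {κ : StarFunctor C Cc}
    (h : IsCompletion C Cc κ) {P : StarFunctor A C} (hP : IsUnitaryEquiv P)
    (hb : Function.Bijective P.obj) : IsCompletion A Cc (P.comp κ) where
  pre X Y f := by rw [← hP.maxNorm]; exact h.pre _ _ _
  cstar := h.cstar
  obj_bij := h.obj_bij.comp hb
  isometric X Y f := by rw [← hP.maxNorm]; exact h.isometric _ _ _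
  dense X Y g ε hε := by
    obtain ⟨f, hf⟩ := h.dense (P.obj X) (P.obj Y) g ε hε
    obtain ⟨f, rfl⟩ := (hP.ff X Y).2 f
    exact ⟨f, hf⟩

theorem square_cstar {A B A' B' : StarCatNu} {F : StarFunctor A B} (hF : IsUnitaryEquiv F)
    {P : StarFunctor A A'} {Q : StarFunctor B B'} (hP : IsCompletion A A' P)
    (hQ : IsCompletion B B' Q)
    {ψ : StarFunctor A' B'} (ho : ∀ X, ψ.obj (P.obj X) = Q.obj (F.obj X))
    (hm : ∀ (X Y : A.Obj) (f : A.Hom X Y),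
      B'.castHom (ho X) (ho Y) (ψ.map (P.map f)) = Q.map (F.map f)) : IsUnitaryEquiv ψ := by
  refine isUnitaryEquiv_of_ff_es ?_ (es_of_square hF.es hQ.unital hQ.obj_bij.2 ho)
  intro X Y
  obtain ⟨X, rfl⟩ := hP.obj_bij.2 X
  obtain ⟨Y, rfl⟩ := hP.obj_bij.2 Y
  have iso0 : ∀ f : A.Hom X Y, B'.maxNorm (ψ.map (P.map f)) = A'.maxNorm (P.map f) := by
    intro f
    rw [← B'.castHom_maxNorm (ho X) (ho Y), hm, hQ.isometric, hF.maxNorm, hP.isometric]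
  have iso : ∀ f : A'.Hom (P.obj X) (P.obj Y), B'.maxNorm (ψ.map f) = A'.maxNorm f := by
    intro f
    apply le_antisymm (ψ.maxNorm_map_le f)
    apply ENNReal.le_of_forall_pos_le_add
    intro ε hε _
    have hε2 : (0 : ℝ≥0∞) < (ε : ℝ≥0∞) / 2 := ENNReal.half_pos (by exact_mod_cast hε.ne')
    obtain ⟨f', hf'⟩ := hP.dense _ _ f (ε / 2) hε2
    have e1 : A'.maxNorm f ≤ A'.maxNorm (f - P.map f') + A'.maxNorm (P.map f') := by
      simpa using A'.maxNorm_add (f - P.map f') (P.map f')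
    have e2 : B'.maxNorm (ψ.map (P.map f')) ≤
        B'.maxNorm (ψ.map (P.map f') - ψ.map f) + B'.maxNorm (ψ.map f) := by
      simpa using B'.maxNorm_add (ψ.map (P.map f') - ψ.map f) (ψ.map f)
    have e3 : B'.maxNorm (ψ.map (P.map f') - ψ.map f) ≤ A'.maxNorm (f - P.map f') := by
      rw [← ψ.map_sub, A'.maxNorm_sub_comm]; exact ψ.maxNorm_map_le _
    calc A'.maxNorm f ≤ A'.maxNorm (f - P.map f') + A'.maxNorm (P.map f') := e1
      _ = A'.maxNorm (f - P.map f') + B'.maxNorm (ψ.map (P.map f')) := by rw [iso0]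
      _ ≤ ε / 2 + (ε / 2 + B'.maxNorm (ψ.map f)) := by
          gcongr
          exact e2.trans (by gcongr; exact e3.trans hf'.le)
      _ = B'.maxNorm (ψ.map f) + ε := by rw [← add_assoc, ENNReal.add_halves, add_comm]
  constructor
  · intro f f' hff
    have hff : ψ.map f = ψ.map f' := hff
    apply sub_eq_zero.1
    apply hP.cstar.2.1
    rw [← iso, ψ.map_sub, hff, sub_self, ← ψ.map_zero, iso]
    have := P.map_zero X Y
    rw [← this, hP.isometric]
    refine le_antisymm (A.maxNorm_le _ _ fun B _ ρ => ?_) bot_le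
    unfold StarCatNu.repNorm
    rw [ρ.map_zero]
    have : ‖(0 : B)‖₊ = 0 := nnnorm_zero
    exact (congrArg (fun z : NNReal => (z : ℝ≥0∞)) this).le
  · intro h
    have hd : ∀ ε : ℝ≥0∞, 0 < ε → ∃ f : A'.Hom (P.obj X) (P.obj Y),
        B'.maxNorm (h - ψ.map f) < ε := by
      intro ε hε
      obtain ⟨d, hd⟩ := hQ.dense _ _ (B'.castHom (ho X) (ho Y) h) ε hε
      obtain ⟨f, rfl⟩ := (hF.ff X Y).2 d
      refine ⟨P.map f, ?_⟩
      have hd : B'.maxNorm (B'.castHom (ho X) (ho Y) h - Q.map (F.map f)) < ε := hd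
      rwa [← hm, ← B'.castHom_sub, B'.castHom_maxNorm] at hd
    have hpos : ∀ n : ℕ, (0 : ℝ≥0∞) < ((n : ℝ≥0∞) + 1)⁻¹ := by
      intro n
      rw [ENNReal.inv_pos]
      exact_mod_cast ENNReal.natCast_ne_top (n + 1)
    choose u hu using fun n : ℕ => hd _ (hpos n)
    have small : ∀ ε : ℝ≥0∞, 0 < ε → ∃ N : ℕ, ∀ n ≥ N, B'.maxNorm (h - ψ.map (u n)) < ε := by
      intro ε hε
      obtain ⟨N, hN⟩ := ENNReal.exists_inv_nat_lt hε.ne'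
      refine ⟨N, fun n hn => (hu n).trans (lt_of_le_of_lt ?_ hN)⟩
      apply ENNReal.inv_le_inv.2
      have : N ≤ n + 1 := by omega
      exact_mod_cast this
    obtain ⟨f, hf⟩ := hP.cstar.2.2 _ _ u (by
      intro ε hε
      obtain ⟨N, hN⟩ := small (ε / 2) (ENNReal.half_pos hε.ne')
      refine ⟨N, fun m hm' n hn => ?_⟩
      rw [← iso, ψ.map_sub]
      calc _ ≤ B'.maxNorm (ψ.map (u m) - h) + B'.maxNorm (h - ψ.map (u n)) :=
            B'.maxNorm_tri _ _ _
        _ < ε / 2 + ε / 2 := by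
            rw [B'.maxNorm_sub_comm]; exact ENNReal.add_lt_add (hN m hm') (hN n hn)
        _ = ε := ENNReal.add_halves ε)
    refine ⟨f, ?_⟩
    symm
    apply hQ.cstar.eq_of_lt
    intro ε hε
    obtain ⟨N, hN⟩ := small (ε / 2) (ENNReal.half_pos hε.ne')
    obtain ⟨M, hM⟩ := hf (ε / 2) (ENNReal.half_pos hε.ne')
    calc _ ≤ B'.maxNorm (h - ψ.map (u (max N M))) + B'.maxNorm (ψ.map (u (max N M)) - ψ.map f) :=
            B'.maxNorm_tri _ _ _
      _ < ε / 2 + ε / 2 := by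
          refine ENNReal.add_lt_add (hN _ (le_max_left _ _)) ?_
          rw [← ψ.map_sub]
          exact (ψ.maxNorm_map_le _).trans_lt (hM _ (le_max_right _ _))
      _ = ε := ENNReal.add_halves ε

/-! ### Pulling back along a map on objects -/

/-- The category with objects `O` and morphisms those of `C` between the images. -/
abbrev StarCatNu.pull (C : StarCatNu) {O : Type} (e : O → C.Obj) : StarCatNu where
  Obj := O
  Hom X Y := C.Hom (e X) (e Y)
  comp g f := C.comp g f
  star f := C.star f
  comp_assoc h g f := C.comp_assoc h g f
  add_comp g g' f := C.add_comp g g' f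
  comp_add g f f' := C.comp_add g f f'
  smul_comp c g f := C.smul_comp c g f
  comp_smul c g f := C.comp_smul c g f
  star_star f := C.star_star f
  star_comp g f := C.star_comp g f
  star_add f f' := C.star_add f f'
  star_smul c f := C.star_smul c f

def StarCatNu.pullInc (C : StarCatNu) {O : Type} (e : O → C.Obj) : StarFunctor (C.pull e) C where
  obj := e
  map f := f
  map_add _ _ _ _ := rfl
  map_smul _ _ _ _ := rfl
  map_comp _ _ _ _ _ := rfl
  map_star _ _ _ := rfl

theorem StarCatNu.pullInc_ff (C : StarCatNu) {O : Type} (e : O → C.Obj) : (C.pullInc e).FF :=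
  fun _ _ => Function.bijective_id

/-! ### Crossed products -/

namespace IsCrossedProductAlg

variable {G : Type} [Group G] {C : StarCatNu} {α : GAction G C} {CG : StarCatNu}

theorem ins_zero (hC : IsCrossedProductAlg G C α CG) (g : G) (X Y : C.Obj) :
    hC.ins g (0 : C.Hom X (α.actObj g⁻¹ Y)) = 0 :=
  (AddMonoidHom.mk' (fun f : C.Hom X (α.actObj g⁻¹ Y) => hC.ins g f) (hC.ins_add g X Y)).map_zero

theorem ind (hC : IsCrossedProductAlg G C α CG) {X Y : C.Obj}
    {p : CG.Hom (hC.obj X) (hC.obj Y) → Prop} (h0 : p 0)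
    (hadd : ∀ u v, p u → p v → p (u + v))
    (hins : ∀ (g : G) (f : C.Hom X (α.actObj g⁻¹ Y)), p (hC.ins g f)) (u) : p u := by
  obtain ⟨s, f, rfl⟩ := hC.span X Y u
  exact Finset.sum_induction _ p hadd h0 (fun g _ => hins g (f g))

/-- The inclusion of `C` into the crossed product. -/
def incl (hC : IsCrossedProductAlg G C α CG) : StarFunctor C (CG.pull hC.obj) where
  obj X := X
  map {X Y} f := hC.ins 1 (C.castHom rfl (α.one_inv_obj Y).symm f)
  map_add X Y f f' := by
    rw [C.castHom_add, hC.ins_add]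
  map_smul X Y c f := by
    rw [C.castHom_smul, hC.ins_smul]
  map_comp X Y Z g f := by
    refine Eq.trans ?_ (hC.ins_comp _ _ _ _ _ _ _).symm
    apply hC.ins_heq (mul_one 1).symm
    refine (C.castHom_heq _ _ _).trans (HEq.trans ?_ (C.castHom_heq _ _ _).symm)
    refine C.comp_heq rfl (α.one_inv_obj Y).symm
      (by rw [α.one_inv_obj, α.one_inv_obj]) ?_ (C.castHom_heq _ _ _).symm
    exact ((α.one_heq inv_one _).trans (C.castHom_heq _ _ _)).symm
  map_star X Y f := by
    refine Eq.trans ?_ (hC.ins_star _ _ _ _).symm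
    apply hC.ins_heq inv_one.symm
    refine (C.castHom_heq _ _ _).trans (HEq.trans ?_ (C.castHom_heq _ _ _).symm)
    refine HEq.trans ?_ (α.one_heq rfl _).symm
    exact C.star_heq rfl (α.one_inv_obj Y).symm (C.castHom_heq _ _ _).symm

theorem incl_unital (hC : IsCrossedProductAlg G C α CG) : hC.incl.Unital := by
  intro X e he
  constructor
  · intro Y f
    change CG.Hom (hC.obj X) (hC.obj Y) at f
    show CG.comp f (hC.ins 1 (C.castHom rfl (α.one_inv_obj X).symm e)) = f
    refine hC.ind (p := fun f => CG.comp f (hC.ins 1 (C.castHom rfl (α.one_inv_obj X).symm e)) = f)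
      (CG.zero_comp _) (fun u v hu hv => by rw [CG.add_comp, hu, hv]) ?_ f
    intro g f
    rw [hC.ins_comp]
    apply hC.ins_heq (mul_one g)
    refine (C.castHom_heq _ _ _).trans ?_
    refine HEq.trans ?_ (heq_of_eq (he.1 _ f))
    exact C.comp_heq rfl (α.one_inv_obj X) (α.one_inv_obj _) (α.one_heq inv_one _)
      (C.castHom_heq _ _ _)
  · intro Y f
    change CG.Hom (hC.obj Y) (hC.obj X) at f
    show CG.comp (hC.ins 1 (C.castHom rfl (α.one_inv_obj X).symm e)) f = f
    refine hC.ind (p := fun f => CG.comp (hC.ins 1 (C.castHom rfl (α.one_inv_obj X).symm e)) f = f)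
      (CG.comp_zero _) (fun u v hu hv => by rw [CG.comp_add, hu, hv]) ?_ f
    intro g f
    rw [hC.ins_comp]
    apply hC.ins_heq (one_mul g)
    refine (C.castHom_heq _ _ _).trans ?_
    have h1 : IsIdentityAt C (α.actMap g⁻¹ e) := by
      have hc : ∀ (Z W : C.Obj) (k : C.Hom Z W),
          HEq (α.actMap g⁻¹ (α.actMap g k)) k := by
        intro Z W k
        refine (C.castHom_heq (α.mul_obj _ _ _) (α.mul_obj _ _ _) _).symm.trans ?_
        rw [α.mul_map]
        exact α.one_heq (inv_mul_cancel g) k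
      have ho : ∀ Z : C.Obj, α.actObj g⁻¹ (α.actObj g Z) = Z := by
        intro Z; rw [α.mul_obj, inv_mul_cancel, α.one_obj]
      constructor
      · intro Z k
        have h2 := he.1 _ (C.castHom (α.cancel_obj g X) rfl (α.actMap g k))
        have h3 := congrArg (fun z => α.actMap g⁻¹ z) h2
        simp only [α.map_comp] at h3
        apply eq_of_heq
        have h4 : HEq (α.actMap g⁻¹ (C.castHom (α.cancel_obj g X) rfl (α.actMap g k))) k :=
          (α.map_heq rfl (α.cancel_obj g X).symm rfl (C.castHom_heq _ _ _)).trans (hc _ _ k)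
        exact (C.comp_heq rfl rfl (ho Z).symm h4.symm HEq.rfl).trans ((heq_of_eq h3).trans h4)
      · intro Z k
        have h2 := he.2 _ (C.castHom rfl (α.cancel_obj g X) (α.actMap g k))
        have h3 := congrArg (fun z => α.actMap g⁻¹ z) h2
        simp only [α.map_comp] at h3
        apply eq_of_heq
        have h4 : HEq (α.actMap g⁻¹ (C.castHom rfl (α.cancel_obj g X) (α.actMap g k))) k :=
          (α.map_heq rfl rfl (α.cancel_obj g X).symm (C.castHom_heq _ _ _)).trans (hc _ _ k)
        exact (C.comp_heq (ho Z).symm rfl rfl HEq.rfl h4.symm).trans ((heq_of_eq h3).trans h4)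
    refine HEq.trans ?_ (heq_of_eq (h1.2 _ f))
    exact C.comp_heq rfl rfl (by rw [α.one_inv_obj])
      (α.map_heq rfl rfl (α.one_inv_obj X) (C.castHom_heq _ _ _)) HEq.rfl

theorem pull_unital (hC : IsCrossedProductAlg G C α CG) (h : C.IsUnital) :
    (CG.pull hC.obj).IsUnital := by
  intro X
  obtain ⟨e, he⟩ := h X
  exact ⟨hC.incl.map e, hC.incl_unital X e he⟩

open Classical in
/-- The linear map from the direct sum. -/
def toHom (hC : IsCrossedProductAlg G C α CG) (X Y : C.Obj) :
    (Π₀ g : G, C.Hom X (α.actObj g⁻¹ Y)) →+ CG.Hom (hC.obj X) (hC.obj Y) :=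
  DFinsupp.liftAddHom fun g => AddMonoidHom.mk' (fun f => hC.ins g f) (hC.ins_add g X Y)

open Classical in
theorem toHom_single (hC : IsCrossedProductAlg G C α CG) (X Y : C.Obj) (g : G)
    (f : C.Hom X (α.actObj g⁻¹ Y)) : hC.toHom X Y (DFinsupp.single g f) = hC.ins g f := by
  unfold toHom
  simp

open Classical in
theorem toHom_bij (hC : IsCrossedProductAlg G C α CG) (X Y : C.Obj) :
    Function.Bijective (hC.toHom X Y) := by
  constructor
  · rw [injective_iff_map_eq_zero]
    intro a ha
    have h1 : hC.toHom X Y a = a.support.sum fun g => hC.ins g (a g) := by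
      conv_lhs => rw [← DFinsupp.sum_single (f := a)]
      rw [DFinsupp.sum, map_sum]
      exact Finset.sum_congr rfl fun g _ => hC.toHom_single X Y g _
    have h2 := hC.indep X Y _ _ (h1.symm.trans ha)
    ext g
    by_cases hg : g ∈ a.support
    · exact h2 g hg
    · simpa using hg
  · intro u
    obtain ⟨s, f, rfl⟩ := hC.span X Y u
    refine ⟨s.sum fun g => DFinsupp.single g (f g), ?_⟩
    rw [map_sum]
    exact Finset.sum_congr rfl fun g _ => hC.toHom_single X Y g _

end IsCrossedProductAlg

section CrossedMap

variable {G : Type} [Group G] {C D : StarCatNu} {α : GAction G C} {β : GAction G D}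
  {φ : StarFunctor C D} {CG DG : StarCatNu}

open Classical in
theorem exists_crossed (hφ : EquivariantMap α β φ)
    (hC : IsCrossedProductAlg G C α CG) (hD : IsCrossedProductAlg G D β DG) (X Y : C.Obj) :
    ∃ L : CG.Hom (hC.obj X) (hC.obj Y) →+ DG.Hom (hD.obj (φ.obj X)) (hD.obj (φ.obj Y)),
      ∀ (g : G) (f : C.Hom X (α.actObj g⁻¹ Y)),
        L (hC.ins g f) = hD.ins g (D.castHom rfl (hφ.obj_comm g⁻¹ Y) (φ.map f)) := by
  let e := AddEquiv.ofBijective (hC.toHom X Y) (hC.toHom_bij X Y)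
  let M : (Π₀ g : G, C.Hom X (α.actObj g⁻¹ Y)) →+ DG.Hom (hD.obj (φ.obj X)) (hD.obj (φ.obj Y)) :=
    DFinsupp.liftAddHom fun g => AddMonoidHom.mk'
      (fun f : C.Hom X (α.actObj g⁻¹ Y) =>
        hD.ins g (D.castHom rfl (hφ.obj_comm g⁻¹ Y) (φ.map f)))
      (fun f f' => by rw [φ.map_add, D.castHom_add, hD.ins_add])
  refine ⟨M.comp e.symm.toAddMonoidHom, fun g f => ?_⟩
  have : e.symm (hC.ins g f) = DFinsupp.single g f := by
    rw [AddEquiv.symm_apply_eq]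
    exact (hC.toHom_single X Y g f).symm
  show M (e.symm (hC.ins g f)) = _
  rw [this]
  simp [M]

def crossedHom (hφ : EquivariantMap α β φ)
    (hC : IsCrossedProductAlg G C α CG) (hD : IsCrossedProductAlg G D β DG) (X Y : C.Obj) :
    CG.Hom (hC.obj X) (hC.obj Y) →+ DG.Hom (hD.obj (φ.obj X)) (hD.obj (φ.obj Y)) :=
  (exists_crossed hφ hC hD X Y).choose

theorem crossedHom_ins (hφ : EquivariantMap α β φ)
    (hC : IsCrossedProductAlg G C α CG) (hD : IsCrossedProductAlg G D β DG) {X Y : C.Obj}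
    (g : G) (f : C.Hom X (α.actObj g⁻¹ Y)) :
    crossedHom hφ hC hD X Y (hC.ins g f) =
      hD.ins g (D.castHom rfl (hφ.obj_comm g⁻¹ Y) (φ.map f)) :=
  (exists_crossed hφ hC hD X Y).choose_spec g f

theorem EquivariantMap.map_heq (hφ : EquivariantMap α β φ) (g : G) {X Y : C.Obj}
    (f : C.Hom X Y) : HEq (φ.map (α.actMap g f)) (β.actMap g (φ.map f)) :=
  (D.castHom_heq _ _ _).symm.trans (heq_of_eq (hφ.map_comm g X Y f))

/-- The induced functor between (pulled back) algebraic crossed products. -/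
def crossedFunctor (hφ : EquivariantMap α β φ)
    (hC : IsCrossedProductAlg G C α CG) (hD : IsCrossedProductAlg G D β DG) :
    StarFunctor (CG.pull hC.obj) (DG.pull hD.obj) where
  obj := φ.obj
  map {X Y} f := crossedHom hφ hC hD X Y f
  map_add X Y f f' := map_add (crossedHom hφ hC hD X Y) f f'
  map_smul X Y c f := by
    refine hC.ind (p := fun f => crossedHom hφ hC hD X Y (c • f) = c • crossedHom hφ hC hD X Y f)
      ?_ ?_ ?_ f
    · rw [smul_zero, map_zero, smul_zero]
    · intro u v hu hv
      rw [smul_add, map_add, map_add, hu, hv, smul_add]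
    · intro g f
      rw [← hC.ins_smul, crossedHom_ins, crossedHom_ins, φ.map_smul, D.castHom_smul, hD.ins_smul]
  map_comp X Y Z g f := by
    refine hC.ind (p := fun f => crossedHom hφ hC hD X Z (CG.comp g f) =
      DG.comp (crossedHom hφ hC hD Y Z g) (crossedHom hφ hC hD X Y f)) ?_ ?_ ?_ f
    · rw [CG.comp_zero, map_zero, map_zero, DG.comp_zero]
    · intro u v hu hv
      rw [CG.comp_add, map_add, map_add, hu, hv, DG.comp_add]
    · intro a f
      refine hC.ind (p := fun g => crossedHom hφ hC hD X Z (CG.comp g (hC.ins a f)) =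
        DG.comp (crossedHom hφ hC hD Y Z g) (crossedHom hφ hC hD X Y (hC.ins a f))) ?_ ?_ ?_ g
      · rw [CG.zero_comp, map_zero, map_zero, DG.zero_comp]
      · intro u v hu hv
        rw [CG.add_comp, map_add, map_add, hu, hv, DG.add_comp]
      · intro b g
        rw [hC.ins_comp, crossedHom_ins, crossedHom_ins, crossedHom_ins, hD.ins_comp]
        apply hD.ins_heq rfl
        refine (D.castHom_heq _ _ _).trans (HEq.trans ?_ (D.castHom_heq _ _ _).symm)
        refine (φ.map_heq rfl (α.inv_mul_obj a b Z).symm (C.castHom_heq _ _ _)).trans ?_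
        rw [φ.map_comp]
        refine D.comp_heq rfl (hφ.obj_comm _ _) ?_ ?_ (D.castHom_heq _ _ _).symm
        · rw [hφ.obj_comm, hφ.obj_comm]
        · exact (hφ.map_heq _ _).trans
            (β.map_heq rfl rfl (hφ.obj_comm _ _) (D.castHom_heq _ _ _).symm)
  map_star X Y f := by
    refine hC.ind (p := fun f => crossedHom hφ hC hD Y X (CG.star f) =
      DG.star (crossedHom hφ hC hD X Y f)) ?_ ?_ ?_ f
    · rw [CG.star_zero', map_zero, map_zero, DG.star_zero']
    · intro u v hu hv
      rw [CG.star_add, map_add, map_add, hu, hv, DG.star_add]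
    · intro g f
      rw [hC.ins_star, crossedHom_ins, crossedHom_ins, hD.ins_star]
      apply hD.ins_heq rfl
      refine (D.castHom_heq _ _ _).trans (HEq.trans ?_ (D.castHom_heq _ _ _).symm)
      refine (φ.map_heq (α.cancel_obj g Y).symm (α.inv_inv_obj g X)
        (C.castHom_heq _ _ _)).trans ?_
      refine (hφ.map_heq _ _).trans ?_
      refine β.map_heq rfl (hφ.obj_comm _ _) rfl ?_
      rw [φ.map_star]
      exact D.star_heq rfl (hφ.obj_comm _ _) (D.castHom_heq _ _ _).symm

theorem crossedFunctor_equiv (hφ : EquivariantMap α β φ)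
    (hC : IsCrossedProductAlg G C α CG) (hD : IsCrossedProductAlg G D β DG)
    (he : IsUnitaryEquiv φ) : IsUnitaryEquiv (crossedFunctor hφ hC hD) := by
  have hb : ∀ (g : G) (X Y : C.Obj), Function.Bijective
      (fun f : C.Hom X (α.actObj g⁻¹ Y) => D.castHom rfl (hφ.obj_comm g⁻¹ Y) (φ.map f)) :=
    fun g X Y => (D.castHom_bij rfl (hφ.obj_comm g⁻¹ Y)).comp (he.ff _ _)
  refine isUnitaryEquiv_of_ff_es ?_ ?_
  · intro X Y
    change Function.Bijective (crossedHom hφ hC hD X Y)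
    constructor
    · rw [injective_iff_map_eq_zero]
      intro u hu
      obtain ⟨s, f, rfl⟩ := hC.span X Y u
      rw [map_sum, Finset.sum_congr rfl fun g _ => crossedHom_ins hφ hC hD g (f g)] at hu
      have h0 := hD.indep _ _ s
        (fun g => D.castHom rfl (hφ.obj_comm g⁻¹ Y) (φ.map (f g))) hu
      apply Finset.sum_eq_zero
      intro g hg
      have h1 : f g = 0 := by
        apply (hb g X Y).1
        show _ = D.castHom rfl (hφ.obj_comm g⁻¹ Y) (φ.map 0)
        rw [φ.map_zero, D.castHom_zero]
        exact h0 g hg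
      rw [h1, hC.ins_zero]
    · intro v
      obtain ⟨s, d, rfl⟩ := hD.span _ _ v
      choose f hf using fun g => (hb g X Y).2 (d g)
      refine ⟨s.sum fun g => hC.ins g (f g), ?_⟩
      rw [map_sum]
      refine Finset.sum_congr rfl fun g _ => ?_
      rw [crossedHom_ins]
      exact congrArg _ (hf g)
  · intro Y
    obtain ⟨X, u, hu⟩ := he.es Y
    exact ⟨X, hD.incl.map u, hD.incl_unital.unitary hu⟩

end CrossedMap

end Helpers

/-- (1) If `φ : C → D` is a weak equivalence in `Fun(BG, ∗Cat_ℂ)` — i.e. an equivariant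
unital morphism of unital ℂ-linear ∗-categories with `G`-action which becomes a unitary
equivalence after forgetting the `G`-action — then the induced morphism
`φ ⋊^alg G : C ⋊^alg G → D ⋊^alg G` is a unitary equivalence.
(2) If `φ : C → D` is a weak equivalence in `Fun(BG, C*Cat)`, then the induced morphism
`φ ⋊ G : C ⋊ G → D ⋊ G` is a unitary equivalence. -/
theorem crossed_product_sends_weak_equivalences_to_unitary_equivalences
    (G : Type) [Group G] :
    -- (1) the algebraic case
    (∀ (C D : StarCatNu), C.IsUnital → D.IsUnital →
      ∀ (α : GAction G C) (β : GAction G D) (φ : StarFunctor C D)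
        (hφ : EquivariantMap α β φ), φ.Unital → IsUnitaryEquiv φ →
      ∀ (CG DG : StarCatNu) (hC : IsCrossedProductAlg G C α CG)
        (hD : IsCrossedProductAlg G D β DG) (ψ : StarFunctor CG DG),
        IsCrossedMap α β φ hφ hC hD ψ → IsUnitaryEquiv ψ) ∧
    -- (2) the C*-categorical case
    (∀ (C D : StarCatNu), IsCStar C → IsCStar D → C.IsUnital → D.IsUnital →
      ∀ (α : GAction G C) (β : GAction G D) (φ : StarFunctor C D)
        (hφ : EquivariantMap α β φ), φ.Unital → IsUnitaryEquiv φ →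
      ∀ (CG DG CGc DGc : StarCatNu) (hC : IsCrossedProductAlg G C α CG)
        (hD : IsCrossedProductAlg G D β DG)
        (κC : StarFunctor CG CGc) (κD : StarFunctor DG DGc),
        IsCompletion CG CGc κC → IsCompletion DG DGc κD →
      ∀ ψ : StarFunctor CGc DGc,
        IsCrossedMapC α β φ hφ hC hD κC κD ψ → IsUnitaryEquiv ψ) := by
  constructor
  · intro C D hCu hDu α β φ hφ _ he CG DG hC hD ψ hψ
    refine square_alg (crossedFunctor_equiv hφ hC hD he) (P := CG.pullInc hC.obj)
      (Q := DG.pullInc hD.obj) (CG.pullInc_ff _) hC.obj_bij.2 (DG.pullInc_ff _) hD.obj_bij.2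
      hψ.obj_eq ?_
    intro X Y f
    refine hC.ind (p := fun f => DG.castHom (hψ.obj_eq X) (hψ.obj_eq Y) (ψ.map f) =
      crossedHom hφ hC hD X Y f) ?_ ?_ ?_ f
    · rw [ψ.map_zero, DG.castHom_zero, map_zero]
    · intro u v hu hv
      rw [ψ.map_add, DG.castHom_add, map_add, hu, hv]
    · intro g f
      rw [hψ.map_eq, crossedHom_ins]
  · intro C D _ _ hCu hDu α β φ hφ _ he CG DG CGc DGc hC hD κC κD hκC hκD ψ hψ
    have hP := isUnitaryEquiv_of_ff_surj (hC.pull_unital hCu) (CG.pullInc_ff hC.obj) hC.obj_bij.2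
    have hQ := isUnitaryEquiv_of_ff_surj (hD.pull_unital hDu) (DG.pullInc_ff hD.obj) hD.obj_bij.2
    refine square_cstar (crossedFunctor_equiv hφ hC hD he) (hκC.precomp hP hC.obj_bij)
      (hκD.precomp hQ hD.obj_bij) hψ.obj_eq ?_
    intro X Y f
    refine hC.ind (p := fun f => DGc.castHom (hψ.obj_eq X) (hψ.obj_eq Y) (ψ.map (κC.map f)) =
      κD.map (crossedHom hφ hC hD X Y f)) ?_ ?_ ?_ f
    · rw [κC.map_zero, ψ.map_zero, DGc.castHom_zero, map_zero, κD.map_zero]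
    · intro u v hu hv
      rw [κC.map_add, ψ.map_add, DGc.castHom_add, map_add, κD.map_add, hu, hv]
    · intro g f
      rw [hψ.map_eq, crossedHom_ins]
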